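/- Let k ≥ 1, C > 0, σ̃ > 0, ε > 0, and δ ∈ [0,1). Suppose Φ(C/(2σ̃) − ε·σ̃/C) − e^ε · Φ(−C/(2σ̃) − ε·σ̃/C) ≤ δ. Then for all x, x' ∈ ℝ^k with ‖x − x'‖₂ ≤ C and every measurable set R ⊆ ℝ^k, the Gaussian measures μ = N_k(x, σ̃²) and μ' = N_k(x', σ̃²) satisfy μ(R) ≤ e^ε · μ'(R) + δ. (This is the 'if' direction of the analytical Gaussian mechanism, Lemma 1: adding isotropic Gaussian noise of standard deviation σ̃ to a function of ℓ₂ sensitivity C yields an (ε,δ)-differentially private mechanism.) -/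

import Mathlib

open MeasureTheory ProbabilityTheory

/-- CDF of the standard normal distribution `N(0,1)`. -/
noncomputable def stdNormalCDF (t : ℝ) : ℝ := ((gaussianReal 0 1) (Set.Iic t)).toReal

/-- Product Gaussian measure on `ℝ^k` with mean vector `x` and common per-coordinate
variance `s` (i.e. `N_k(x, s)` with variance parameter `s`). -/
noncomputable def gaussPi (k : ℕ) (x : Fin k → ℝ) (s : NNReal) : Measure (Fin k → ℝ) :=
  Measure.pi fun j => gaussianReal (x j) s

/-- Hockey-stick divergence `D_α(μ‖ν) = sup_{S measurable} (μ(S) - α·ν(S))`. -/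
noncomputable def hsDiv {X : Type*} [MeasurableSpace X] (α : ℝ) (μ ν : Measure X) : ℝ :=
  ⨆ S : {S : Set X // MeasurableSet S}, ((μ S.1).toReal - α * (ν S.1).toReal)

/-- Gaussian upper tails in terms of the standard normal CDF. -/
lemma toReal_gaussianReal_Ici (m t : ℝ) {s : ℝ} (hs : 0 < s) :
    (gaussianReal m (s ^ 2).toNNReal (Set.Ici t)).toReal = stdNormalCDF ((m - t) / s) := by
  have hlaw : (gaussianReal 0 1).map (fun y ↦ m - s * y) = gaussianReal m (s ^ 2).toNNReal := by
    have hcomp : (fun y : ℝ ↦ m - s * y) = (fun y ↦ m - y) ∘ (fun y ↦ s * y) := rfl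
    rw [hcomp, ← Measure.map_map (by fun_prop) (by fun_prop), gaussianReal_map_const_mul,
      gaussianReal_map_const_sub]
    congr 1
    · simp
    · ext; simp [sq_nonneg]
  rw [← hlaw, Measure.map_apply (by fun_prop) measurableSet_Ici, stdNormalCDF]
  congr 2
  ext y
  simp only [Set.mem_preimage, Set.mem_Ici, Set.mem_Iic, le_div_iff₀ hs]
  constructor <;> intro h <;> linarith

/-- A linear functional of a Gaussian vector with independent coordinates is Gaussian. -/
lemma gaussPi_map_linear (k : ℕ) (x c : Fin k → ℝ) (v : NNReal) :
    (gaussPi k x v).map (fun z ↦ ∑ j, c j * z j) =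
      gaussianReal (∑ j, c j * x j) ((∑ j, c j ^ 2).toNNReal * v) := by
  have hind : iIndepFun (fun j (z : Fin k → ℝ) ↦ c j * z j) (gaussPi k x v) :=
    iIndepFun_pi (X := fun j y ↦ c j * y) fun j ↦ by fun_prop
  have hmap (j : Fin k) : (gaussPi k x v).map (fun z ↦ c j * z j) =
      gaussianReal (c j * x j) ((c j ^ 2).toNNReal * v) := by
    have hcomp : (fun z : Fin k → ℝ ↦ c j * z j) = (fun y ↦ c j * y) ∘ Function.eval j := rfl
    rw [hcomp, ← Measure.map_map (by fun_prop) (by fun_prop), gaussPi,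
      (measurePreserving_eval _ j).map_eq, gaussianReal_map_const_mul]
    congr 2
    ext; simp [sq_nonneg]
  have : IsProbabilityMeasure (gaussPi k x v) := by unfold gaussPi; infer_instance
  have : IsProbabilityMeasure ((gaussPi k x v).map (fun z ↦ ∑ j, c j * z j)) :=
    Measure.isProbabilityMeasure_map
      (Measurable.aemeasurable (by fun_prop))
  apply Measure.ext_of_charFun
  rw [hind.charFun_map_fun_sum_eq_prod fun j ↦ Measurable.aemeasurable (by fun_prop)]
  ext t
  simp only [Finset.prod_apply, hmap, charFun_gaussianReal, ← Complex.exp_sum]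
  have hsq (j : Fin k) : (((c j ^ 2).toNNReal : ℝ)) = c j ^ 2 := Real.coe_toNNReal _ (sq_nonneg _)
  have hsum : (((∑ j, c j ^ 2).toNNReal : ℝ)) = ∑ j, c j ^ 2 :=
    Real.coe_toNNReal _ (Finset.sum_nonneg fun j _ ↦ sq_nonneg _)
  congr 1
  simp only [NNReal.coe_mul, hsq, hsum]
  push_cast
  simp only [Finset.sum_sub_distrib, ← Finset.sum_div, ← Finset.sum_mul, Finset.mul_sum]

lemma integrable_prod_gaussianPDFReal (k : ℕ) (x : Fin k → ℝ) (v : NNReal) :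
    Integrable (fun z : Fin k → ℝ ↦ ∏ j, gaussianPDFReal (x j) v (z j)) :=
  Integrable.fintype_prod (μ := fun _ : Fin k ↦ (volume : Measure ℝ))
    fun j ↦ integrable_gaussianPDFReal (x j) v

lemma gaussPi_eq_withDensity (k : ℕ) (x : Fin k → ℝ) {v : NNReal} (hv : v ≠ 0) :
    gaussPi k x v = (volume : Measure (Fin k → ℝ)).withDensity
      fun z ↦ ENNReal.ofReal (∏ j, gaussianPDFReal (x j) v (z j)) := by
  refine Measure.pi_eq fun s hs ↦ ?_
  rw [withDensity_apply _ (MeasurableSet.univ_pi hs), ← ofReal_integral_eq_lintegral_ofReal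
    (integrable_prod_gaussianPDFReal k x v).restrict
    (ae_of_all _ fun z ↦ Finset.prod_nonneg fun j _ ↦ gaussianPDFReal_nonneg _ _ _),
    volume_pi, Measure.restrict_pi_pi, integral_fintype_prod_eq_prod,
    ENNReal.ofReal_prod_of_nonneg
      fun j _ ↦ integral_nonneg fun y ↦ gaussianPDFReal_nonneg _ _ _]
  exact Finset.prod_congr rfl fun j _ ↦ (gaussianReal_apply_eq_integral _ hv _).symm

lemma toReal_gaussPi_apply (k : ℕ) (x : Fin k → ℝ) {v : NNReal} (hv : v ≠ 0)
    {R : Set (Fin k → ℝ)} (hR : MeasurableSet R) :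
    (gaussPi k x v R).toReal = ∫ z in R, ∏ j, gaussianPDFReal (x j) v (z j) := by
  have hnonneg (z : Fin k → ℝ) : 0 ≤ ∏ j, gaussianPDFReal (x j) v (z j) :=
    Finset.prod_nonneg fun j _ ↦ gaussianPDFReal_nonneg _ _ _
  rw [gaussPi_eq_withDensity k x hv, withDensity_apply _ hR, ← ofReal_integral_eq_lintegral_ofReal
    (integrable_prod_gaussianPDFReal k x v).restrict (ae_of_all _ hnonneg),
    ENNReal.toReal_ofReal (integral_nonneg hnonneg)]

/-- The likelihood ratio of two isotropic Gaussians exceeds `exp ε` exactly on a half-space. -/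
lemma exp_mul_prod_gaussianPDFReal_le_iff (k : ℕ) (x x' z : Fin k → ℝ) (ε : ℝ) {v : NNReal}
    (hv : v ≠ 0) :
    Real.exp ε * ∏ j, gaussianPDFReal (x' j) v (z j) ≤ ∏ j, gaussianPDFReal (x j) v (z j) ↔
      v * ε + ∑ j, (x j ^ 2 - x' j ^ 2) / 2 ≤ ∑ j, (x j - x' j) * z j := by
  have hv' : (0 : ℝ) < v := by positivity
  simp only [gaussianPDFReal, Finset.prod_mul_distrib, ← Real.exp_sum]
  rw [mul_left_comm, mul_le_mul_iff_right₀ (by positivity), ← Real.exp_add, Real.exp_le_exp,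
    ← sub_nonneg, ← mul_nonneg_iff_of_pos_left hv', ← sub_nonneg (b := _ + _)]
  refine iff_of_eq (congrArg _ ?_)
  rw [mul_sub, mul_add, Finset.mul_sum, Finset.mul_sum, sub_add_eq_sub_sub, sub_add_eq_sub_sub,
    sub_right_comm, ← Finset.sum_sub_distrib, sub_right_comm, ← Finset.sum_sub_distrib]
  congr 1
  refine Finset.sum_congr rfl fun j _ ↦ ?_
  field_simp
  ring

lemma toReal_gaussPi_halfSpace (k : ℕ) (x c : Fin k → ℝ) (t : ℝ) {d σ : ℝ} (hd : 0 < d)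
    (hσ : 0 < σ) (hc : ∑ j, c j ^ 2 = d ^ 2) :
    (gaussPi k x (σ ^ 2).toNNReal {z | t ≤ ∑ j, c j * z j}).toReal =
      stdNormalCDF ((∑ j, c j * x j - t) / (d * σ)) := by
  rw [← toReal_gaussianReal_Ici _ _ (mul_pos hd hσ), mul_pow, Real.toNNReal_mul (sq_nonneg d),
    ← hc, ← gaussPi_map_linear, Measure.map_apply (by fun_prop) measurableSet_Ici]
  rfl

/-- The Neyman–Pearson bound for two isotropic Gaussians at Euclidean distance `d`. -/
lemma toReal_gaussPi_sub_le (k : ℕ) (x x' : Fin k → ℝ) (ε : ℝ) {d σ : ℝ} (hd : 0 < d)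
    (hσ : 0 < σ) (hdist : ∑ j, (x j - x' j) ^ 2 = d ^ 2) {R : Set (Fin k → ℝ)}
    (hR : MeasurableSet R) :
    (gaussPi k x (σ ^ 2).toNNReal R).toReal -
        Real.exp ε * (gaussPi k x' (σ ^ 2).toNNReal R).toReal ≤
      stdNormalCDF (d / (2 * σ) - ε * σ / d) -
        Real.exp ε * stdNormalCDF (-(d / (2 * σ)) - ε * σ / d) := by
  set v := (σ ^ 2).toNNReal with hv_def
  have hv : v ≠ 0 := by simpa [hv_def] using hσ.ne'
  have hv_coe : (v : ℝ) = σ ^ 2 := Real.coe_toNNReal _ (sq_nonneg _)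
  set t := v * ε + ∑ j, (x j ^ 2 - x' j ^ 2) / 2 with ht
  have hint := integrable_prod_gaussianPDFReal k x v
  have hint' := (integrable_prod_gaussianPDFReal k x' v).const_mul (Real.exp ε)
  have hdiff {S : Set (Fin k → ℝ)} (hS : MeasurableSet S) :
      (gaussPi k x v S).toReal - Real.exp ε * (gaussPi k x' v S).toReal =
        ∫ z in S, (∏ j, gaussianPDFReal (x j) v (z j) -
          Real.exp ε * ∏ j, gaussianPDFReal (x' j) v (z j)) := by
    rw [toReal_gaussPi_apply k x hv hS, toReal_gaussPi_apply k x' hv hS,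
      integral_sub hint.restrict hint'.restrict, integral_const_mul]
  have hset : {z : Fin k → ℝ | 0 ≤ ∏ j, gaussianPDFReal (x j) v (z j) -
      Real.exp ε * ∏ j, gaussianPDFReal (x' j) v (z j)} = {z | t ≤ ∑ j, (x j - x' j) * z j} := by
    ext z
    simp only [Set.mem_ofPred_eq, sub_nonneg, exp_mul_prod_gaussianPDFReal_le_iff k x x' z ε hv, ht]
  have hmeas : Measurable fun z : Fin k → ℝ ↦ ∏ j, gaussianPDFReal (x j) v (z j) -
      Real.exp ε * ∏ j, gaussianPDFReal (x' j) v (z j) := by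
    have (y : Fin k → ℝ) : Measurable fun z : Fin k → ℝ ↦ ∏ j, gaussianPDFReal (y j) v (z j) :=
      Finset.measurable_fun_prod _ fun j _ ↦
        (measurable_gaussianPDFReal _ _).comp (measurable_pi_apply j)
    exact (this x).sub ((this x').const_mul _)
  have harg : (∑ j, (x j - x' j) * x j - t) / (d * σ) = d / (2 * σ) - ε * σ / d := by
    have : ∑ j, (x j - x' j) * x j - ∑ j, (x j ^ 2 - x' j ^ 2) / 2 = d ^ 2 / 2 := by
      rw [← hdist, ← Finset.sum_sub_distrib, Finset.sum_div]
      exact Finset.sum_congr rfl fun j _ ↦ by ring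
    rw [ht, hv_coe, add_comm, ← sub_sub, this]
    field_simp
  have harg' : (∑ j, (x j - x' j) * x' j - t) / (d * σ) = -(d / (2 * σ)) - ε * σ / d := by
    have : ∑ j, (x j - x' j) * x' j - ∑ j, (x j ^ 2 - x' j ^ 2) / 2 = -(d ^ 2 / 2) := by
      rw [← hdist, ← Finset.sum_sub_distrib, Finset.sum_div, ← Finset.sum_neg_distrib]
      exact Finset.sum_congr rfl fun j _ ↦ by ring
    rw [ht, hv_coe, add_comm, ← sub_sub, this]
    field_simp
  calc
    _ = ∫ z in R, (∏ j, gaussianPDFReal (x j) v (z j) -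
          Real.exp ε * ∏ j, gaussianPDFReal (x' j) v (z j)) := hdiff hR
    _ ≤ ∫ z in {z : Fin k → ℝ | t ≤ ∑ j, (x j - x' j) * z j}, (∏ j, gaussianPDFReal (x j) v (z j) -
          Real.exp ε * ∏ j, gaussianPDFReal (x' j) v (z j)) := by
      rw [← hset]
      exact setIntegral_le_nonneg hR hmeas.stronglyMeasurable (hint.sub hint')
    _ = _ := by
      rw [← hdiff (measurableSet_le measurable_const (by fun_prop)),
        toReal_gaussPi_halfSpace k x _ t hd hσ hdist,
        toReal_gaussPi_halfSpace k x' _ t hd hσ hdist, harg, harg']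

lemma hasDerivAt_stdNormalCDF (t : ℝ) :
    HasDerivAt stdNormalCDF (gaussianPDFReal 0 1 t) t := by
  have hint := integrable_gaussianPDFReal 0 1
  have hcont : Continuous (gaussianPDFReal 0 1) := by
    rw [gaussianPDFReal_def]; fun_prop
  have heq : stdNormalCDF = fun b ↦
      (∫ y in (0 : ℝ)..b, gaussianPDFReal 0 1 y) + ∫ y in Set.Iic 0, gaussianPDFReal 0 1 y := by
    ext b
    rw [← intervalIntegral.integral_Iic_sub_Iic hint.integrableOn hint.integrableOn,
      sub_add_cancel, stdNormalCDF, gaussianReal_apply_eq_integral _ one_ne_zero,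
      ENNReal.toReal_ofReal (integral_nonneg fun y ↦ gaussianPDFReal_nonneg _ _ _)]
  rw [heq]
  exact (intervalIntegral.integral_hasDerivAt_right (hcont.intervalIntegrable _ _)
    (hcont.stronglyMeasurableAtFilter _ _) hcont.continuousAt).add_const _

/-- The privacy profile of the Gaussian mechanism is monotone in the sensitivity. -/
lemma monotoneOn_gaussianPrivacyProfile (ε : ℝ) {σ : ℝ} (hσ : 0 < σ) :
    MonotoneOn (fun d ↦ stdNormalCDF (d / (2 * σ) - ε * σ / d) -
      Real.exp ε * stdNormalCDF (-(d / (2 * σ)) - ε * σ / d)) (Set.Ioi 0) := by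
  have hderiv (d : ℝ) (hd : 0 < d) : HasDerivAt
      (fun d ↦ stdNormalCDF (d / (2 * σ) - ε * σ / d) -
        Real.exp ε * stdNormalCDF (-(d / (2 * σ)) - ε * σ / d))
      (gaussianPDFReal 0 1 (d / (2 * σ) - ε * σ / d) / σ) d := by
    have h₁ : HasDerivAt (fun d : ℝ ↦ d / (2 * σ)) (1 / (2 * σ)) d :=
      (hasDerivAt_id d).div_const _
    have h₂ : HasDerivAt (fun d : ℝ ↦ ε * σ / d) (-(ε * σ / d ^ 2)) d := by
      simpa [div_eq_mul_inv] using (hasDerivAt_inv hd.ne').const_mul (ε * σ)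
    have hpdf : Real.exp ε * gaussianPDFReal 0 1 (-(d / (2 * σ)) - ε * σ / d) =
        gaussianPDFReal 0 1 (d / (2 * σ) - ε * σ / d) := by
      simp only [gaussianPDFReal]
      rw [mul_left_comm, ← Real.exp_add]
      congr 2
      push_cast
      field_simp
      ring
    refine (((hasDerivAt_stdNormalCDF _).comp d (h₁.fun_sub h₂)).fun_sub
      (((hasDerivAt_stdNormalCDF _).comp d (h₁.fun_neg.fun_sub h₂)).const_mul
        (Real.exp ε))).congr_deriv ?_
    rw [← mul_assoc, hpdf]
    field_simp
    ring
  refine monotoneOn_of_deriv_nonneg (convex_Ioi 0)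
    (fun d hd ↦ (hderiv d hd).continuousAt.continuousWithinAt)
    (fun d hd ↦ (hderiv d (interior_subset hd)).differentiableAt.differentiableWithinAt)
    fun d hd ↦ ?_
  rw [(hderiv d (interior_subset hd)).deriv]
  exact div_nonneg (gaussianPDFReal_nonneg _ _ _) hσ.le

/-- **Lemma 1, 'if' direction** (analytical Gaussian mechanism): if
`Φ(C/(2σ̃) - εσ̃/C) - e^ε Φ(-C/(2σ̃) - εσ̃/C) ≤ δ`, then for any two means at Euclidean
distance at most `C`, the isotropic Gaussians with per-coordinate variance `σ̃²` satisfy the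
`(ε,δ)`-DP inequality on every measurable set. -/
theorem stmt2 (k : ℕ) (hk : 1 ≤ k) (C σt ε δ : ℝ)
    (hC : 0 < C) (hσ : 0 < σt) (hε : 0 < ε) (hδ0 : 0 ≤ δ) (hδ1 : δ < 1)
    (hcond : stdNormalCDF (C / (2 * σt) - ε * σt / C)
        - Real.exp ε * stdNormalCDF (-(C / (2 * σt)) - ε * σt / C) ≤ δ) :
    ∀ x x' : Fin k → ℝ, Real.sqrt (∑ j, (x j - x' j) ^ 2) ≤ C →
      ∀ R : Set (Fin k → ℝ), MeasurableSet R →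
        ((gaussPi k x ((σt ^ 2).toNNReal)) R).toReal ≤
          Real.exp ε * ((gaussPi k x' ((σt ^ 2).toNNReal)) R).toReal + δ := by
  intro x x' hx R hR
  rcases (Real.sqrt_nonneg (∑ j, (x j - x' j) ^ 2)).eq_or_lt with h0 | hpos
  · have hsum := (Real.sqrt_eq_zero (Finset.sum_nonneg fun j _ ↦ sq_nonneg _)).1 h0.symm
    have hxx : x = x' := by
      ext j
      have := (Finset.sum_eq_zero_iff_of_nonneg fun j _ ↦ sq_nonneg _).1 hsum j (Finset.mem_univ j)
      exact sub_eq_zero.1 (pow_eq_zero_iff two_ne_zero |>.1 this)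
    subst hxx
    have := le_mul_of_one_le_left (ENNReal.toReal_nonneg (a := gaussPi k x (σt ^ 2).toNNReal R))
      (Real.one_le_exp hε.le)
    linarith
  · have hNP := toReal_gaussPi_sub_le k x x' ε hpos hσ
      (Real.sq_sqrt (Finset.sum_nonneg fun j _ ↦ sq_nonneg _)).symm hR
    have hmono := monotoneOn_gaussianPrivacyProfile ε hσ hpos hC hx
    dsimp only at hmono
    linarith
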